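/- arXiv:math/9807008 — 6 statements merged into one kernel-verified Lean document; each statement's English description precedes it below -/
import Mathlib

section
/- Let H be a real Hilbert space and A : H →L[ℝ] H a bounded self-adjoint operator which is positive (⟪A x, x⟫ ≥ 0 for all x). Let 0 < a < b be real numbers and suppose there exist closed subspaces H₁, H₂ of H with H₁ ∩ H₂ = {0} and H₁ + H₂ = H such that ⟪A x, x⟫ ≤ a‖x‖² for all x ∈ H₁ and ⟪A x, x⟫ ≥ b‖x‖² for all x ∈ H₂. Then the spectrum of A does not intersect the open interval (a, b), i.e. spectrum ℝ A ∩ (a,b) = ∅. -/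
open RealInnerProductSpace

/-- **Mini-max spectral gap criterion (bounded case).**
If `A` is a bounded self-adjoint positive operator on a real Hilbert space `H`,
`0 < a < b`, and `H` decomposes as `H₁ + H₂` with `H₁ ∩ H₂ = {0}` for closed
subspaces `H₁, H₂` on which the quadratic form of `A` is bounded above by `a‖·‖²`
(resp. below by `b‖·‖²`), then the spectrum of `A` misses the interval `(a, b)`. -/
theorem spectrum_gap_of_quadratic_form_bounds
    {H : Type*} [NormedAddCommGroup H] [InnerProductSpace ℝ H] [CompleteSpace H]
    (A : H →L[ℝ] H) (hA : IsSelfAdjoint A)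
    (hpos : ∀ x : H, 0 ≤ ⟪A x, x⟫)
    (a b : ℝ) (ha : 0 < a) (hab : a < b)
    (H₁ H₂ : Submodule ℝ H)
    (hH₁ : IsClosed (H₁ : Set H)) (hH₂ : IsClosed (H₂ : Set H))
    (hinter : H₁ ⊓ H₂ = ⊥) (hsum : H₁ ⊔ H₂ = ⊤)
    (h₁ : ∀ x ∈ H₁, ⟪A x, x⟫ ≤ a * ‖x‖ ^ 2)
    (h₂ : ∀ x ∈ H₂, b * ‖x‖ ^ 2 ≤ ⟪A x, x⟫) :
    spectrum ℝ A ∩ Set.Ioo a b = ∅ := by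
  have hsym : ∀ x y : H, ⟪A x, y⟫ = ⟪x, A y⟫ := fun x y => hA.isSymmetric x y
  rw [Set.eq_empty_iff_forall_notMem]
  rintro l ⟨hl, hal, hlb⟩
  rw [spectrum.mem_iff] at hl
  apply hl
  set T : H →L[ℝ] H := algebraMap ℝ (H →L[ℝ] H) l - A with hT
  have hTx : ∀ x, T x = l • x - A x := fun x => by
    simp [hT, Algebra.algebraMap_eq_smul_one]
  have hTs : ∀ x y : H, ⟪T x, y⟫ = ⟪x, T y⟫ := fun x y => by
    rw [hTx, hTx, inner_sub_left, inner_sub_right, hsym, real_inner_smul_left,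
      real_inner_smul_right]
  obtain ⟨c, hc, hc1, hc2⟩ : ∃ c : ℝ, 0 < c ∧ c ≤ l - a ∧ c ≤ b - l :=
    ⟨min (l - a) (b - l), lt_min (by linarith) (by linarith), min_le_left _ _, min_le_right _ _⟩
  have key : ∀ x, c / 2 * ‖x‖ ≤ ‖T x‖ := by
    intro x
    obtain ⟨u, hu, v, hv, rfl⟩ := Submodule.mem_sup.1 (hsum ▸ Submodule.mem_top : x ∈ H₁ ⊔ H₂)
    have e : ⟪T (u + v), u - v⟫ = ⟪T u, u⟫ - ⟪T v, v⟫ := by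
      rw [map_add, inner_add_left, inner_sub_right, inner_sub_right, hTs u v,
        real_inner_comm (T v) u]
      ring
    have eu : c * ‖u‖ ^ 2 ≤ ⟪T u, u⟫ := by
      rw [hTx, inner_sub_left, real_inner_smul_left, real_inner_self_eq_norm_sq]
      nlinarith [h₁ u hu, sq_nonneg ‖u‖]
    have ev : c * ‖v‖ ^ 2 ≤ - ⟪T v, v⟫ := by
      rw [hTx, inner_sub_left, real_inner_smul_left, real_inner_self_eq_norm_sq]
      nlinarith [h₂ v hv, sq_nonneg ‖v‖]
    have h3 : ⟪T (u + v), u - v⟫ ≤ ‖T (u + v)‖ * (‖u‖ + ‖v‖) :=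
      (real_inner_le_norm _ _).trans
        (mul_le_mul_of_nonneg_left (norm_sub_le _ _) (norm_nonneg _))
    have h4 := norm_add_le u v
    rcases (add_nonneg (norm_nonneg u) (norm_nonneg v)).eq_or_lt with h0 | h0
    · have : ‖u + v‖ = 0 := le_antisymm (by linarith) (norm_nonneg _)
      rw [this, mul_zero]
      exact norm_nonneg _
    · have h5 : c / 2 * (‖u‖ + ‖v‖) ≤ ‖T (u + v)‖ := by
        refine le_of_mul_le_mul_right ?_ h0
        nlinarith [mul_nonneg hc.le (sq_nonneg (‖u‖ - ‖v‖))]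
      exact (mul_le_mul_of_nonneg_left h4 (by positivity)).trans h5
  have hinj : ∀ x, T x = 0 → x = 0 := fun x hx => by
    have := key x
    rw [hx, norm_zero] at this
    exact norm_le_zero_iff.1 (nonpos_of_mul_nonpos_right this (by positivity))
  rw [ContinuousLinearMap.isUnit_iff_bijective,
    ContinuousLinearMap.bijective_iff_dense_range_and_antilipschitz]
  refine ⟨?_, (Real.toNNReal (c / 2))⁻¹, T.antilipschitz_of_bound fun x => ?_⟩
  · rw [Submodule.topologicalClosure_eq_top_iff, Submodule.eq_bot_iff]
    intro x hx
    apply hinj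
    have := hx (T (T x)) ⟨T x, rfl⟩
    rw [hTs] at this
    exact inner_self_eq_zero.1 this
  · rw [NNReal.coe_inv, inv_mul_eq_div, Real.coe_toNNReal _ (by positivity), le_div_iff₀ (by positivity), mul_comm]
    exact key x
end

section
/- Let H be a real Hilbert space and A : H →ₗ.[ℝ] H a densely defined self-adjoint partial linear operator (A equals its adjoint A† as partial linear maps) which is positive (⟪A x, x⟫ ≥ 0 for all x in the domain of A). Let 0 < a < b be real numbers and suppose there exist closed subspaces H₁, H₂ of H with H₁ ∩ H₂ = {0}, H₁ + H₂ = H, and H₁ contained in the domain of A, such that ⟪A x, x⟫ ≤ a‖x‖² for all x ∈ H₁, and ⟪A x, x⟫ ≥ b‖x‖² for all x in H₂ ∩ (domain of A). Then for every μ ∈ (a, b) the map sending x in the domain of A to A x − μ x is a bijection from the domain of A onto H; in particular every μ ∈ (a,b) lies in the resolvent set of A. -/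
open RealInnerProductSpace

/-- **Mini-max spectral gap criterion (unbounded case, Lemma 4.1).**
Let `A` be a densely defined self-adjoint positive partial linear operator on a
real Hilbert space `H`, let `0 < a < b`, and suppose `H` decomposes as
`H₁ + H₂` with `H₁ ∩ H₂ = {0}` for closed subspaces `H₁ ⊆ dom A` and `H₂`, on
which the quadratic form of `A` is bounded above by `a‖·‖²` (resp. below by
`b‖·‖²` on `H₂ ∩ dom A`). Then for every `μ ∈ (a, b)`, the operator `A - μ` is
a bijection from `dom A` onto `H`; i.e. `(a, b)` lies in the resolvent set. -/
theorem linearPMap_gap_of_quadratic_form_bounds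
    {H : Type*} [NormedAddCommGroup H] [InnerProductSpace ℝ H] [CompleteSpace H]
    (A : H →ₗ.[ℝ] H) (hdense : Dense (A.domain : Set H))
    (hsa : IsSelfAdjoint A)
    (hpos : ∀ x : A.domain, 0 ≤ ⟪A x, (x : H)⟫)
    (a b : ℝ) (ha : 0 < a) (hab : a < b)
    (H₁ H₂ : Submodule ℝ H)
    (hH₁ : IsClosed (H₁ : Set H)) (hH₂ : IsClosed (H₂ : Set H))
    (hinter : H₁ ⊓ H₂ = ⊥) (hsum : H₁ ⊔ H₂ = ⊤)
    (hdom : H₁ ≤ A.domain)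
    (h₁ : ∀ x : A.domain, (x : H) ∈ H₁ → ⟪A x, (x : H)⟫ ≤ a * ‖(x : H)‖ ^ 2)
    (h₂ : ∀ x : A.domain, (x : H) ∈ H₂ → b * ‖(x : H)‖ ^ 2 ≤ ⟪A x, (x : H)⟫) :
    ∀ μ ∈ Set.Ioo a b,
      Function.Bijective (fun x : A.domain => A x - μ • (x : H)) := by
  have hadj : A.adjoint = A := hsa
  have hsym : ∀ x y : A.domain, ⟪A x, (y : H)⟫ = ⟪(x : H), A y⟫ := by
    have h := LinearPMap.adjoint_isFormalAdjoint hdense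
    rw [hadj] at h
    exact h
  have hcl : IsClosed (A.graph : Set (H × H)) := by
    have h := LinearPMap.adjoint_isClosed hdense
    rw [hadj] at h
    exact h
  rintro μ ⟨hμa, hμb⟩
  obtain ⟨δ, hδ, hδa, hδb⟩ : ∃ δ : ℝ, 0 < δ ∧ δ ≤ μ - a ∧ δ ≤ b - μ :=
    ⟨min (μ - a) (b - μ), lt_min (by linarith) (by linarith), min_le_left _ _, min_le_right _ _⟩
  have key : ∀ x : A.domain, δ / 2 * ‖(x : H)‖ ≤ ‖A x - μ • (x : H)‖ := by
    intro x
    have hx : (x : H) ∈ H₁ ⊔ H₂ := by rw [hsum]; trivial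
    obtain ⟨u, hu, v, hv, huv⟩ := Submodule.mem_sup.1 hx
    have hud := hdom hu
    have hvd : v ∈ A.domain := by
      have : v = x - u := by rw [← huv]; abel
      rw [this]; exact A.domain.sub_mem x.2 hud
    obtain ⟨U, hU⟩ : ∃ U : A.domain, (U : H) = u := ⟨⟨u, hud⟩, rfl⟩
    obtain ⟨V, hV⟩ : ∃ V : A.domain, (V : H) = v := ⟨⟨v, hvd⟩, rfl⟩
    subst hU hV
    have hxe : x = U + V := Subtype.ext (by rw [← huv]; rfl)
    have e1 := h₁ U hu
    have e2 := h₂ V hv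
    have e3 := hsym U V
    have hin : ⟪A x - μ • (x : H), (V : H) - U⟫
        = (⟪A V, (V : H)⟫ - μ * ‖(V : H)‖ ^ 2) - (⟪A U, (U : H)⟫ - μ * ‖(U : H)‖ ^ 2) := by
      rw [hxe, LinearPMap.map_add]
      simp only [Submodule.coe_add, inner_sub_left, inner_sub_right, inner_add_left,
        real_inner_smul_left, smul_add, real_inner_self_eq_norm_sq]
      rw [e3, real_inner_comm (U : H) (A V), real_inner_comm (U : H) (V : H)]
      ring
    have hcs := real_inner_le_norm (A x - μ • (x : H)) ((V : H) - U)
    have hn1 : ‖(V : H) - U‖ ≤ ‖(U : H)‖ + ‖(V : H)‖ := by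
      rw [add_comm]; exact norm_sub_le _ _
    have hn2 : ‖(x : H)‖ ≤ ‖(U : H)‖ + ‖(V : H)‖ := by
      rw [← huv]; exact norm_add_le _ _
    have hN := norm_nonneg (A x - μ • (x : H))
    set N := ‖A x - μ • (x : H)‖
    have hp := norm_nonneg (U : H)
    have hq := norm_nonneg (V : H)
    generalize ‖(U : H)‖ = p at *
    generalize ‖(V : H)‖ = q at *
    have f1 : δ * (p ^ 2 + q ^ 2) ≤ N * (p + q) := by
      have := mul_le_mul_of_nonneg_left hn1 hN
      have := mul_le_mul_of_nonneg_right hδa (sq_nonneg p)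
      have := mul_le_mul_of_nonneg_right hδb (sq_nonneg q)
      linarith
    have f2 : δ / 2 * (p + q) * (p + q) ≤ N * (p + q) := by
      nlinarith [mul_nonneg hδ.le (sq_nonneg (p - q))]
    rcases (add_nonneg hp hq).eq_or_lt with h0 | h0
    · rw [← h0] at hn2
      have : δ / 2 * ‖(x : H)‖ ≤ δ / 2 * 0 := by gcongr
      linarith
    · have := le_of_mul_le_mul_right f2 h0
      exact (mul_le_mul_of_nonneg_left hn2 (by positivity)).trans this
  have hker : ∀ x : A.domain, A x - μ • (x : H) = 0 → x = 0 := by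
    intro x hx
    have := key x
    rw [hx, norm_zero] at this
    have h0 : ‖(x : H)‖ ≤ 0 := by
      by_contra h
      push Not at h
      have := mul_pos (half_pos hδ) h
      linarith
    exact Subtype.ext (norm_le_zero_iff.1 h0)
  constructor
  · intro x y hxy
    rw [← sub_eq_zero]
    apply hker
    have hxy' : A x - μ • (x : H) = A y - μ • (y : H) := hxy
    rw [LinearPMap.map_sub, Submodule.coe_sub, smul_sub, sub_sub_sub_comm, hxy', sub_self]
  · have : CompleteSpace A.graph := hcl.completeSpace_coe
    let T : A.graph →L[ℝ] H :=
      (ContinuousLinearMap.snd ℝ H H - μ • ContinuousLinearMap.fst ℝ H H).comp A.graph.subtypeL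
    have hT : ∀ p : A.graph, T p = (p : H × H).2 - μ • (p : H × H).1 := fun p => rfl
    have hal : AntilipschitzWith (Real.toNNReal (1 + (|μ| + 1) * (2 / δ))) T := by
      apply AddMonoidHomClass.antilipschitz_of_bound
      rintro ⟨⟨x, y⟩, hp⟩
      obtain ⟨X, hX, hY⟩ := (LinearPMap.mem_graph_iff A).1 hp
      simp only at hX hY
      subst hX hY
      have hk := key X
      rw [hT, Real.coe_toNNReal _ (by positivity)]
      change max ‖(X : H)‖ ‖A X‖ ≤ _ * ‖A X - μ • (X : H)‖
      have hn : ‖A X‖ ≤ ‖A X - μ • (X : H)‖ + |μ| * ‖(X : H)‖ := by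
        have := norm_add_le (A X - μ • (X : H)) (μ • (X : H))
        rwa [sub_add_cancel, norm_smul, Real.norm_eq_abs] at this
      set N := ‖A X - μ • (X : H)‖ with hNdef
      have hN : 0 ≤ N := norm_nonneg _
      have hx : ‖(X : H)‖ ≤ 2 / δ * N := by
        rw [div_mul_eq_mul_div, le_div_iff₀ hδ]; linarith
      have h1 := mul_le_mul_of_nonneg_left hx (abs_nonneg μ)
      have h2 : 0 ≤ 2 / δ * N := by positivity
      have h3 : 0 ≤ |μ| * (2 / δ * N) := by positivity
      apply max_le <;> nlinarith
    have hrc : IsClosed (T.range : Set H) := by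
      have := hal.isClosed_range T.uniformContinuous
      rw [LinearMap.coe_range]
      exact this
    have : CompleteSpace T.range := hrc.completeSpace_coe
    have htop : T.range = ⊤ := by
      rw [← Submodule.orthogonal_eq_bot_iff, eq_bot_iff]
      intro y hy
      have hy' : ∀ x : A.domain, ⟪μ • y, (x : H)⟫ = ⟪y, A x⟫ := by
        intro x
        have := (Submodule.mem_orthogonal' _ _).1 hy _
          (LinearMap.mem_range_self T.toLinearMap ⟨((x : H), A x), A.mem_graph x⟩)
        change ⟪y, A x - μ • (x : H)⟫ = 0 at this
        rw [inner_sub_right, real_inner_smul_right] at this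
        rw [real_inner_smul_left]; linarith
      have hyd : y ∈ A.adjoint.domain := LinearPMap.mem_adjoint_domain_of_exists y ⟨_, hy'⟩
      have hyv := LinearPMap.adjoint_apply_eq hdense ⟨y, hyd⟩ hy'
      have : (y, μ • y) ∈ A.adjoint.graph := by
        rw [← hyv]; exact A.adjoint.mem_graph ⟨y, hyd⟩
      rw [hadj] at this
      obtain ⟨X, hX, hY⟩ := (LinearPMap.mem_graph_iff A).1 this
      simp only at hX hY
      have h0 := hker X (by rw [hX, hY, sub_self])
      rw [← hX, h0]; simp
    intro z
    have hz : z ∈ T.range := by rw [htop]; trivial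
    obtain ⟨⟨⟨x, y⟩, hp⟩, hpz⟩ := hz
    obtain ⟨X, hX, hY⟩ := (LinearPMap.mem_graph_iff A).1 hp
    simp only at hX hY
    subst hX hY
    exact ⟨X, hpz⟩
end

section
/- Let n ≥ 1, t > 0 real, and α : Fin n → ℕ a multi-index. Define f : EuclideanSpace ℝ (Fin n) → ℝ by f(x) = (∏_{i} He_{α(i)}(√(2t)·x_i)) · exp(−t‖x‖²/2). Then f is smooth and for every x, −Δf(x) + t²‖x‖² f(x) = (n + 2·∑_i α(i))·t·f(x), where Δf(x) = ∑_{i} D²f(x)(e_i, e_i) is the Laplacian (the sum of the second directional derivatives of f at x along the standard orthonormal basis vectors e_i). -/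
open scoped BigOperators

/-- The Laplacian of `f : ℝⁿ → ℝ` at `x`: the sum of the second directional
derivatives of `f` at `x` along the standard orthonormal basis vectors. -/
noncomputable def euclideanLaplacian {n : ℕ} (f : EuclideanSpace ℝ (Fin n) → ℝ)
    (x : EuclideanSpace ℝ (Fin n)) : ℝ :=
  ∑ i : Fin n,
    fderiv ℝ (fun y => fderiv ℝ f y (EuclideanSpace.single i 1)) x
      (EuclideanSpace.single i 1)

lemma hermite_ode (k : ℕ) :
    Polynomial.derivative (Polynomial.derivative (Polynomial.hermite k))
      = Polynomial.X * Polynomial.derivative (Polynomial.hermite k)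
        - (k : Polynomial ℤ) * Polynomial.hermite k := by
  induction k with
  | zero => simp
  | succ k ih =>
    have h1 : Polynomial.derivative (Polynomial.hermite (k+1))
        = ((k : Polynomial ℤ) + 1) * Polynomial.hermite k := by
      rw [Polynomial.hermite_succ, Polynomial.derivative_sub, Polynomial.derivative_mul,
        Polynomial.derivative_X, ih]
      ring
    have h2 : Polynomial.derivative (((k : Polynomial ℤ) + 1) * Polynomial.hermite k)
        = ((k : Polynomial ℤ) + 1) * Polynomial.derivative (Polynomial.hermite k) := by
      have := Polynomial.derivative_natCast_mul (R := ℤ) (n := k+1) (f := Polynomial.hermite k)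
      push_cast at this
      exact this
    rw [h1, h2, Polynomial.hermite_succ]
    push_cast
    ring

noncomputable def hermG (t : ℝ) (k : ℕ) (u : ℝ) : ℝ :=
  Polynomial.aeval (Real.sqrt (2 * t) * u) (Polynomial.hermite k) * Real.exp (-t * u ^ 2 / 2)

noncomputable def hermG' (t : ℝ) (k : ℕ) (u : ℝ) : ℝ :=
  (Polynomial.aeval (Real.sqrt (2 * t) * u) (Polynomial.derivative (Polynomial.hermite k))
      * Real.sqrt (2 * t)
    - t * u * Polynomial.aeval (Real.sqrt (2 * t) * u) (Polynomial.hermite k))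
    * Real.exp (-t * u ^ 2 / 2)

lemma hasDerivAt_aux (s : ℝ) (p : Polynomial ℤ) (u : ℝ) :
    HasDerivAt (fun u : ℝ => Polynomial.aeval (s * u) p)
      (Polynomial.aeval (s * u) (Polynomial.derivative p) * s) u := by
  have h : HasDerivAt (fun u : ℝ => s * u) s u := by
    simpa using (hasDerivAt_id u).const_mul s
  exact (Polynomial.hasDerivAt_aeval p (s * u)).comp u h

lemma hasDerivAt_gauss (t u : ℝ) :
    HasDerivAt (fun u : ℝ => Real.exp (-t * u ^ 2 / 2))
      (Real.exp (-t * u ^ 2 / 2) * (-t * u)) u := by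
  have h : HasDerivAt (fun u : ℝ => -t * u ^ 2 / 2) (-t * u) u := by
    have := ((hasDerivAt_pow 2 u).const_mul (-t)).div_const 2
    refine this.congr_deriv ?_
    norm_num
    ring
  exact h.exp

lemma hermG_deriv (t : ℝ) (k : ℕ) (u : ℝ) : HasDerivAt (hermG t k) (hermG' t k u) u := by
  have := (hasDerivAt_aux (Real.sqrt (2 * t)) (Polynomial.hermite k) u).mul (hasDerivAt_gauss t u)
  refine this.congr_deriv ?_
  unfold hermG'
  ring

lemma hermG'_deriv (t : ℝ) (ht : 0 < t) (k : ℕ) (u : ℝ) :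
    HasDerivAt (hermG' t k) ((t ^ 2 * u ^ 2 - (1 + 2 * k) * t) * hermG t k u) u := by
  have h1 := (hasDerivAt_aux (Real.sqrt (2 * t))
    (Polynomial.derivative (Polynomial.hermite k)) u).mul_const (Real.sqrt (2 * t))
  have h2 := ((hasDerivAt_id u).const_mul t).mul
    (hasDerivAt_aux (Real.sqrt (2 * t)) (Polynomial.hermite k) u)
  have := (h1.sub h2).mul (hasDerivAt_gauss t u)
  refine this.congr_deriv ?_
  have hs : Real.sqrt (2 * t) * Real.sqrt (2 * t) = 2 * t := Real.mul_self_sqrt (by positivity)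
  have e : Polynomial.aeval (Real.sqrt (2 * t) * u)
      (Polynomial.derivative (Polynomial.derivative (Polynomial.hermite k)))
      = (Real.sqrt (2 * t) * u) * Polynomial.aeval (Real.sqrt (2 * t) * u)
        (Polynomial.derivative (Polynomial.hermite k))
        - k * Polynomial.aeval (Real.sqrt (2 * t) * u) (Polynomial.hermite k) := by
    rw [hermite_ode]; simp
  simp only [Pi.mul_apply, Pi.sub_apply, id, e, hermG]
  generalize Polynomial.aeval (Real.sqrt (2 * t) * u) (Polynomial.hermite k) = a
  generalize Polynomial.aeval (Real.sqrt (2 * t) * u)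
        (Polynomial.derivative (Polynomial.hermite k)) = b
  generalize Real.sqrt (2 * t) = s at *
  generalize Real.exp (-t * u ^ 2 / 2) = E
  linear_combination (u * b * s - k * a) * E * hs

lemma prod_fderiv {n : ℕ} (g : Fin n → ℝ → ℝ) (g' : Fin n → ℝ) (y : EuclideanSpace ℝ (Fin n))
    (h : ∀ i, HasDerivAt (g i) (g' i) (y i)) (j : Fin n) :
    fderiv ℝ (fun x : EuclideanSpace ℝ (Fin n) => ∏ i, g i (x i)) y (EuclideanSpace.single j 1)
      = (∏ i ∈ Finset.univ.erase j, g i (y i)) * g' j := by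
  have hp : ∀ i ∈ (Finset.univ : Finset (Fin n)),
      HasFDerivAt (fun x : EuclideanSpace ℝ (Fin n) => g i (x i))
        (g' i • (EuclideanSpace.proj i : EuclideanSpace ℝ (Fin n) →L[ℝ] ℝ)) y := fun i _ =>
    (h i).comp_hasFDerivAt y
      (EuclideanSpace.proj i : EuclideanSpace ℝ (Fin n) →L[ℝ] ℝ).hasFDerivAt
  have := HasFDerivAt.finsetProd hp
  rw [this.fderiv]
  simp

/-- **Harmonic oscillator eigenfunctions in `n` variables.**
For `t > 0` and a multi-index `α : Fin n → ℕ`, the product Hermite function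
`f x = (∏ i, He_{α i}(√(2t)·xᵢ)) · exp(−t‖x‖²/2)` is smooth and satisfies
`−Δf + t²‖x‖²f = (n + 2∑ᵢ αᵢ)·t·f`. -/
theorem hermite_product_is_harmonic_oscillator_eigenfunction
    (n : ℕ) (hn : 1 ≤ n) (t : ℝ) (ht : 0 < t) (α : Fin n → ℕ) :
    let f : EuclideanSpace ℝ (Fin n) → ℝ := fun x =>
      (∏ i : Fin n, Polynomial.aeval (Real.sqrt (2 * t) * x i)
        (Polynomial.hermite (α i))) * Real.exp (-t * ‖x‖ ^ 2 / 2)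
    ContDiff ℝ (⊤ : ℕ∞) f ∧
      ∀ x : EuclideanSpace ℝ (Fin n),
        -(euclideanLaplacian f x) + t ^ 2 * ‖x‖ ^ 2 * f x
          = ((n : ℝ) + 2 * ∑ i : Fin n, (α i : ℝ)) * t * f x := by
  intro f
  have hnorm : ∀ x : EuclideanSpace ℝ (Fin n), ‖x‖ ^ 2 = ∑ i, x i ^ 2 := fun x => by
    rw [EuclideanSpace.norm_sq_eq]; simp
  have hf : f = fun x => ∏ i, hermG t (α i) (x i) := by
    funext x
    simp only [f, hermG, Finset.prod_mul_distrib, ← Real.exp_sum]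
    rw [hnorm, Finset.mul_sum, Finset.sum_div]
  have hsm : ∀ k, ContDiff ℝ (⊤ : ℕ∞) (hermG t k) := fun k => by
    unfold hermG
    have := (Polynomial.contDiff_aeval (𝕜 := ℝ) (Polynomial.hermite k) (⊤ : ℕ∞)).comp
      (contDiff_const.mul contDiff_id : ContDiff ℝ (⊤ : ℕ∞) (fun u : ℝ => Real.sqrt (2 * t) * u))
    refine this.mul ?_
    fun_prop
  refine ⟨?_, fun x => ?_⟩
  · rw [hf]
    refine contDiff_prod fun i _ => (hsm _).comp ?_
    exact (EuclideanSpace.proj i : EuclideanSpace ℝ (Fin n) →L[ℝ] ℝ).contDiff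
  have key : ∀ j, fderiv ℝ (fun y => fderiv ℝ f y (EuclideanSpace.single j 1)) x
      (EuclideanSpace.single j 1) = (t ^ 2 * x j ^ 2 - (1 + 2 * α j) * t) * f x := by
    intro j
    have h1 : (fun y => fderiv ℝ f y (EuclideanSpace.single j 1)) = fun y =>
        ∏ i, (Function.update (fun i => hermG t (α i)) j (hermG' t (α j))) i (y i) := by
      funext y
      rw [hf, prod_fderiv _ (fun i => hermG' t (α i) (y i)) y (fun i => hermG_deriv _ _ _) j,
        ← Finset.prod_erase_mul _ _ (Finset.mem_univ j)]
      congr 1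
      · refine Finset.prod_congr rfl fun i hi => ?_
        rw [Function.update_of_ne (Finset.ne_of_mem_erase hi)]
      · simp
    rw [h1, prod_fderiv _ (Function.update (fun i => hermG' t (α i) (x i)) j
      ((t ^ 2 * x j ^ 2 - (1 + 2 * α j) * t) * hermG t (α j) (x j))) x ?_ j]
    · rw [hf]
      simp only
      rw [← Finset.prod_erase_mul _ _ (Finset.mem_univ j), Function.update_self]
      rw [Finset.prod_congr rfl fun i hi => by
        rw [Function.update_of_ne (Finset.ne_of_mem_erase hi)]]
      ring
    · intro i
      by_cases hij : i = j
      · subst hij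
        simpa using hermG'_deriv t ht (α i) (x i)
      · simpa [Function.update_of_ne hij] using hermG_deriv t (α i) (x i)
  unfold euclideanLaplacian
  rw [Finset.sum_congr rfl fun j _ => key j, ← Finset.sum_mul, Finset.sum_sub_distrib,
    ← Finset.mul_sum, ← Finset.sum_mul, Finset.sum_add_distrib, ← Finset.mul_sum, hnorm]
  simp
  ring
end

section
/- Let n ≥ 1, t > 0 real, and f : EuclideanSpace ℝ (Fin n) → ℝ a smooth function with compact support satisfying the orthogonality condition ∫ f(x)·exp(−t‖x‖²/2) dx = 0. Then (n+2)·t·∫ f(x)² dx ≤ ∫ (‖Df(x)‖² + t²‖x‖²·f(x)²) dx, where Df(x) denotes the Fréchet derivative (gradient) of f at x and all integrals are with respect to Lebesgue measure on ℝⁿ. -/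
open MeasureTheory

set_option linter.unusedSectionVars false

section aux
variable {E : Type*} [NormedAddCommGroup E] [InnerProductSpace ℝ E] [FiniteDimensional ℝ E]
  [MeasurableSpace E] [BorelSpace E]

/-- Gaussian weight. -/
noncomputable def gw (t : ℝ) (x : E) : ℝ := Real.exp (-t * ‖x‖ ^ 2)

theorem gw_pos (t : ℝ) (x : E) : 0 < gw t x := Real.exp_pos _

theorem gw_cont (t : ℝ) : Continuous (gw t : E → ℝ) := by
  unfold gw; fun_prop

theorem gw_int {t : ℝ} (ht : 0 < t) : Integrable (gw t : E → ℝ) := by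
  by_contra h
  have h1 : ∫ x : E, gw t x = 0 := integral_undef h
  have h2 := GaussianFourier.integral_rexp_neg_mul_sq_norm (V := E) ht
  have : 0 < ∫ x : E, gw t x := by
    unfold gw; rw [h2]; positivity
  linarith

theorem gw_norm_int {t : ℝ} (ht : 0 < t) : Integrable (fun x : E => ‖x‖ * gw t x) := by
  refine Integrable.mono' (((gw_int (E := E) (t := t/2) (by positivity)).const_mul (1/t+1)))
    (by have := gw_cont (E := E) t; fun_prop) (Filter.Eventually.of_forall fun x => ?_)
  have h0 := gw_pos t x
  rw [Real.norm_of_nonneg (by positivity)]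
  have h1 : gw t x = gw (t/2) x * Real.exp (-(t/2*‖x‖^2)) := by
    unfold gw; rw [← Real.exp_add]; congr 1; ring
  rw [h1]
  have h2 : ‖x‖ * Real.exp (-(t/2*‖x‖^2)) ≤ 1/t+1 := by
    rw [Real.exp_neg, ← div_eq_mul_inv, div_le_iff₀ (Real.exp_pos _)]
    have h3 := Real.add_one_le_exp (t/2*‖x‖^2)
    have h4 : (1/t+1) * (t/2*‖x‖^2+1) ≤ (1/t+1) * Real.exp (t/2*‖x‖^2) := by gcongr
    refine le_trans ?_ h4
    have h5 : (1/t+1) * (t/2*‖x‖^2+1) = 1/t + ‖x‖^2/2 + 1 + t/2*‖x‖^2 := by field_simp; ring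
    rw [h5]
    have : 0 < 1/t := by positivity
    have : 0 ≤ t/2*‖x‖^2 := by positivity
    nlinarith [sq_nonneg (‖x‖-1)]
  have := gw_pos (t/2) x
  nlinarith

theorem gw2_int {t : ℝ} (ht : 0 < t) : Integrable (fun p : E × E => gw t p.1 * gw t p.2) :=
  (gw_int ht).mul_prod (gw_int ht)

theorem gw2_norm_int {t : ℝ} (ht : 0 < t) :
    Integrable (fun p : E × E => (‖p.1‖ + ‖p.2‖) * (gw t p.1 * gw t p.2)) := by
  have h1 : Integrable (fun p : E × E => (‖p.1‖ * gw t p.1) * gw t p.2) :=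
    (gw_norm_int ht).mul_prod (gw_int ht)
  have h2 : Integrable (fun p : E × E => gw t p.1 * (‖p.2‖ * gw t p.2)) :=
    (gw_int ht).mul_prod (gw_norm_int ht)
  refine (h1.add h2).congr (Filter.Eventually.of_forall fun p => ?_)
  simp only [Pi.add_apply]; ring

/-- rotation on the L2 product -/
noncomputable def rotL (c s : ℝ) (h : c^2+s^2=1) : WithLp 2 (E × E) ≃ₗᵢ[ℝ] WithLp 2 (E × E) where
  toFun p := WithLp.toLp 2 (c • p.fst - s • p.snd, s • p.fst + c • p.snd)
  invFun p := WithLp.toLp 2 (c • p.fst + s • p.snd, (-s) • p.fst + c • p.snd)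
  map_add' p q := by
    refine WithLp.ofLp_injective 2 (Prod.ext ?_ ?_)
    · simp; module
    · simp; module
  map_smul' a q := by
    refine WithLp.ofLp_injective 2 (Prod.ext ?_ ?_)
    · simp; module
    · simp; module
  left_inv p := by
    refine WithLp.ofLp_injective 2 (Prod.ext ?_ ?_)
    · change c • (c • p.fst - s • p.snd) + s • (s • p.fst + c • p.snd) = p.fst
      linear_combination (norm := module) h • p.fst
    · change (-s) • (c • p.fst - s • p.snd) + c • (s • p.fst + c • p.snd) = p.snd
      linear_combination (norm := module) h • p.snd
  right_inv p := by
    refine WithLp.ofLp_injective 2 (Prod.ext ?_ ?_)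
    · change c • (c • p.fst + s • p.snd) - s • ((-s) • p.fst + c • p.snd) = p.fst
      linear_combination (norm := module) h • p.fst
    · change s • (c • p.fst + s • p.snd) + c • ((-s) • p.fst + c • p.snd) = p.snd
      linear_combination (norm := module) h • p.snd
  norm_map' p := by
    rw [← sq_eq_sq₀ (norm_nonneg _) (norm_nonneg _), WithLp.prod_norm_sq_eq_of_L2,
      WithLp.prod_norm_sq_eq_of_L2]
    change ‖c • p.fst - s • p.snd‖^2 + ‖s • p.fst + c • p.snd‖^2 = ‖p.fst‖^2 + ‖p.snd‖^2
    simp only [norm_sub_sq_real, norm_add_sq_real,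
      norm_smul, inner_smul_left, inner_smul_right, mul_pow, Real.norm_eq_abs, sq_abs]
    simp
    linear_combination (‖p.fst‖^2 + ‖p.snd‖^2) * h

theorem rot_mp (c s : ℝ) (h : c^2+s^2=1) :
    MeasurePreserving (fun p : E × E => (c • p.1 - s • p.2, s • p.1 + c • p.2)) := by
  have := ((WithLp.volume_preserving_ofLp E E).comp
    (rotL (E := E) c s h).measurePreserving).comp (WithLp.volume_preserving_toLp E E)
  exact this

theorem rot_int (c s : ℝ) (h : c^2+s^2=1) (F : E × E → ℝ) :
    ∫ p : E × E, F (c • p.1 - s • p.2, s • p.1 + c • p.2) = ∫ p, F p := by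
  have hm := rot_mp (E := E) c s h
  refine hm.integral_comp ?_ F
  exact (((MeasurableEquiv.toLp 2 (E × E)).trans
    (rotL (E := E) c s h).toHomeomorph.toMeasurableEquiv).trans
    (MeasurableEquiv.toLp 2 (E × E)).symm).measurableEmbedding

theorem gw_rot (t c s : ℝ) (h : c^2+s^2=1) (x y : E) :
    gw t (c • x - s • y) * gw t (s • x + c • y) = gw t x * gw t y := by
  unfold gw
  rw [← Real.exp_add, ← Real.exp_add]
  congr 1
  simp only [norm_sub_sq_real, norm_add_sq_real,
      norm_smul, inner_smul_left, inner_smul_right, mul_pow, Real.norm_eq_abs, sq_abs]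
  simp
  linear_combination -t* (‖x‖^2 + ‖y‖^2) * h

theorem int_bdd {G : E × E → ℝ} {t : ℝ} (ht : 0 < t) (hG : Continuous G) (C : ℝ)
    (hC : ∀ p, |G p| ≤ C) : Integrable (fun p => G p * (gw t p.1 * gw t p.2)) := by
  refine Integrable.mono' ((gw2_int ht).const_mul C)
    (by have := gw_cont (E := E) t; fun_prop) (Filter.Eventually.of_forall fun p => ?_)
  have := gw_pos t p.1
  have := gw_pos t p.2
  rw [norm_mul, Real.norm_eq_abs, Real.norm_of_nonneg (by positivity)]
  gcongr
  exact hC p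

theorem int_lin {G : E × E → ℝ} {t : ℝ} (ht : 0 < t) (hG : Continuous G) (C : ℝ)
    (hC : ∀ p, |G p| ≤ C * (‖p.1‖ + ‖p.2‖)) :
    Integrable (fun p => G p * (gw t p.1 * gw t p.2)) := by
  refine Integrable.mono' ((gw2_norm_int ht).const_mul C)
    (by have := gw_cont (E := E) t; fun_prop) (Filter.Eventually.of_forall fun p => ?_)
  have := gw_pos t p.1
  have := gw_pos t p.2
  rw [norm_mul, Real.norm_eq_abs, Real.norm_of_nonneg (by positivity), ← mul_assoc C]
  exact mul_le_mul_of_nonneg_right (hC p) (by positivity)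

theorem gw_fderiv (t : ℝ) (x : E) :
    HasFDerivAt (gw t : E → ℝ) ((-2 * t * gw t x) • innerSL ℝ x) x := by
  have h := (((hasStrictFDerivAt_norm_sq x).hasFDerivAt).const_mul (-t)).exp
  refine h.congr_fderiv ?_
  ext v
  simp [gw]
  ring

/-- Gaussian integration by parts -/
theorem gibp {t : ℝ} (ht : 0 < t) {h : E → ℝ} (hh : ContDiff ℝ 1 h) (A B : ℝ)
    (hA : ∀ x, |h x| ≤ A) (hB : ∀ x, ‖fderiv ℝ h x‖ ≤ B) (a : E) :
    ∫ v, h v * (inner ℝ v a * gw t v) = 1/(2*t) * ∫ v, fderiv ℝ h v a * gw t v := by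
  have hc := gw_cont (E := E) t
  have hhc := hh.continuous
  have hdc := (hh.continuous_fderiv one_ne_zero)
  have hgf : ∀ v : E, fderiv ℝ (gw t) v a = (-2*t) * (inner ℝ v a * gw t v) := by
    intro v; rw [(gw_fderiv t v).fderiv]; simp; ring
  have key := integral_mul_fderiv_eq_neg_fderiv_mul_of_integrable (μ := volume) (f := h)
    (g := gw t) (v := a) ?_ ?_ ?_ (fun x _ => (hh.differentiable one_ne_zero) x)
    (fun x _ => (gw_fderiv t x).differentiableAt)
  · simp_rw [hgf] at key
    have e : ∀ v : E, h v * ((-2*t) * (inner ℝ v a * gw t v)) =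
      (-2*t) * (h v * (inner ℝ v a * gw t v)) := fun v => by ring
    simp_rw [e] at key
    rw [integral_const_mul] at key
    rw [one_div, eq_inv_mul_iff_mul_eq₀ (by positivity)]
    linarith
  · refine Integrable.mono' ((gw_int ht).const_mul (B*‖a‖))
      (by fun_prop) (Filter.Eventually.of_forall fun p => ?_)
    have := gw_pos t p
    rw [norm_mul, Real.norm_of_nonneg this.le]
    gcongr
    exact (ContinuousLinearMap.le_opNorm _ _).trans (by gcongr; exact hB p)
  · simp_rw [hgf]
    refine Integrable.mono' ((gw_norm_int ht).const_mul (A*(2*t)*‖a‖))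
      (by fun_prop) (Filter.Eventually.of_forall fun p => ?_)
    have := gw_pos t p
    have hA0 : 0 ≤ A := (abs_nonneg _).trans (hA p)
    have h1 : ‖(-2*t : ℝ)‖ = 2*t := by rw [Real.norm_eq_abs, abs_of_neg (by linarith)]; ring
    rw [norm_mul, norm_mul (-2*t), h1, norm_mul, Real.norm_of_nonneg this.le]
    calc ‖h p‖ * (2*t*(‖(inner ℝ p a : ℝ)‖ * gw t p)) ≤ A * (2*t*((‖p‖*‖a‖) * gw t p)) := by
          gcongr
          · exact hA p
          · exact norm_inner_le_norm _ _
      _ = _ := by ring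
  · refine Integrable.mono' ((gw_int ht).const_mul A)
      (by have := hh.continuous; fun_prop) (Filter.Eventually.of_forall fun p => ?_)
    have := gw_pos t p
    rw [norm_mul, Real.norm_of_nonneg this.le]
    gcongr
    exact hA p

theorem dH_bound {t : ℝ} (ht : 0 < t) {g : E → ℝ} (hg : ContDiff ℝ 1 g) (A B : ℝ)
    (hA : ∀ x, |g x| ≤ A) (hB : ∀ x, ‖fderiv ℝ g x‖ ≤ B) (c s : ℝ) (h : c^2+s^2=1) (hs : 0 ≤ s) :
    -(s * (1/(2*t) * ∫ p : E × E, ‖fderiv ℝ g p.1‖^2 * (gw t p.1 * gw t p.2))) ≤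
    ∫ p : E × E, g p.1 * fderiv ℝ g (c • p.1 + s • p.2) (-s • p.1 + c • p.2)
      * (gw t p.1 * gw t p.2) := by
  have hgc := hg.continuous
  have hwc := gw_cont (E := E) t
  have hdc := hg.continuous_fderiv one_ne_zero
  have hgd := hg.differentiable one_ne_zero
  -- rotate
  have e1 : ∫ p : E × E, g p.1 * fderiv ℝ g (c • p.1 + s • p.2) (-s • p.1 + c • p.2)
      * (gw t p.1 * gw t p.2) =
      ∫ p : E × E, g (c • p.1 - s • p.2) * fderiv ℝ g p.1 p.2 * (gw t p.1 * gw t p.2) := by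
    rw [← rot_int c s h]
    refine integral_congr_ae (Filter.Eventually.of_forall fun p => ?_)
    dsimp only
    have u : c • (c • p.1 - s • p.2) + s • (s • p.1 + c • p.2) = p.1 := by
      linear_combination (norm := module) h • p.1
    have v : -s • (c • p.1 - s • p.2) + c • (s • p.1 + c • p.2) = p.2 := by
      linear_combination (norm := module) h • p.2
    rw [u, v, gw_rot t c s h]
  have hB0 : 0 ≤ B := (norm_nonneg _).trans (hB 0)
  have hA0 : 0 ≤ A := (abs_nonneg _).trans (hA 0)
  have i1 : Integrable (fun p : E × E => g (c • p.1 - s • p.2) * fderiv ℝ g p.1 p.2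
      * (gw t p.1 * gw t p.2)) := by
    refine int_lin ht (by fun_prop) (A * B) fun p => ?_
    rw [abs_mul, mul_assoc]
    have : |fderiv ℝ g p.1 p.2| ≤ B * (‖p.1‖ + ‖p.2‖) := by
      refine (ContinuousLinearMap.le_opNorm (fderiv ℝ g p.1) p.2).trans ?_
      gcongr
      · exact hB _
      · linarith [norm_nonneg p.1]
    gcongr
    exact hA _
  -- the gradient
  let G : E → E := fun u => (InnerProductSpace.toDual ℝ E).symm (fderiv ℝ g u)
  have hG : ∀ u v, inner ℝ v (G u) = fderiv ℝ g u v := fun u v => by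
    rw [real_inner_comm]; exact InnerProductSpace.toDual_symm_apply
  have hGn : ∀ u, ‖G u‖ = ‖fderiv ℝ g u‖ := fun u => LinearIsometryEquiv.norm_map _ _
  have hGc : Continuous G := (LinearIsometryEquiv.continuous _).comp hdc
  have bnd : ∀ p : E × E, |fderiv ℝ g (c • p.1 - s • p.2) (G p.1)| ≤
      (‖fderiv ℝ g (c • p.1 - s • p.2)‖^2 + ‖fderiv ℝ g p.1‖^2)/2 := by
    intro p
    refine (ContinuousLinearMap.le_opNorm (fderiv ℝ g (c • p.1 - s • p.2)) (G p.1)).trans ?_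
    rw [hGn]
    nlinarith [sq_nonneg (‖fderiv ℝ g (c • p.1 - s • p.2)‖ - ‖fderiv ℝ g p.1‖)]
  have sqb : ∀ x, ‖fderiv ℝ g x‖^2 ≤ B^2 := fun x => by
    have := hB x
    gcongr
  have i2 : Integrable (fun p : E × E => fderiv ℝ g (c • p.1 - s • p.2) (G p.1)
      * (gw t p.1 * gw t p.2)) := by
    refine int_bdd ht (by fun_prop) (B^2) fun p => ?_
    have := sqb (c • p.1 - s • p.2)
    have := sqb p.1
    linarith [bnd p]
  have i3 : Integrable (fun p : E × E => ‖fderiv ℝ g p.1‖^2 * (gw t p.1 * gw t p.2)) := by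
    refine int_bdd ht (by fun_prop) (B^2) fun p => ?_
    rw [abs_of_nonneg (by positivity)]; exact sqb _
  have i4 : Integrable (fun p : E × E => ‖fderiv ℝ g (c • p.1 - s • p.2)‖^2
      * (gw t p.1 * gw t p.2)) := by
    refine int_bdd ht (by fun_prop) (B^2) fun p => ?_
    rw [abs_of_nonneg (by positivity)]; exact sqb _
  -- integrate by parts
  have e2 : ∫ p : E × E, g (c • p.1 - s • p.2) * fderiv ℝ g p.1 p.2 * (gw t p.1 * gw t p.2)
      = -(s * (1/(2*t) * ∫ p : E × E, fderiv ℝ g (c • p.1 - s • p.2) (G p.1)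
      * (gw t p.1 * gw t p.2))) := by
    rw [Measure.volume_eq_prod, integral_prod _ i1, integral_prod _ i2, ← integral_const_mul,
      ← integral_const_mul, ← integral_neg]
    refine integral_congr_ae (Filter.Eventually.of_forall fun u => ?_)
    dsimp only
    have hd : ∀ v, HasFDerivAt (fun v => g (c • u - s • v))
        ((-s) • fderiv ℝ g (c • u - s • v)) v := by
      intro v
      have h1 : HasFDerivAt (fun v : E => c • u - s • v) (-(s • ContinuousLinearMap.id ℝ E)) v :=
        ((hasFDerivAt_id v).const_smul s).const_sub _
      refine ((hgd _).hasFDerivAt.comp v h1).congr_fderiv ?_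
      ext w; simp
    have hcd : ContDiff ℝ 1 (fun v => g (c • u - s • v)) := by fun_prop
    have k := gibp ht hcd A (s * B) (fun v => hA _) (fun v => by
      rw [(hd v).fderiv, norm_smul, norm_neg, Real.norm_of_nonneg hs]
      gcongr
      exact hB _) (G u)
    simp_rw [fun v => (hd v).fderiv, hG] at k
    have l : ∀ v, g (c • u - s • v) * fderiv ℝ g u v * (gw t u * gw t v) =
      gw t u * (g (c • u - s • v) * (fderiv ℝ g u v * gw t v)) := fun v => by ring
    have r : ∀ v, fderiv ℝ g (c • u - s • v) (G u) * (gw t u * gw t v) =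
      gw t u * (fderiv ℝ g (c • u - s • v) (G u) * gw t v) := fun v => by ring
    have m : ∀ v, ((-s) • fderiv ℝ g (c • u - s • v)) (G u) * gw t v =
      (-s) * (fderiv ℝ g (c • u - s • v) (G u) * gw t v) := fun v => by simp [mul_assoc]
    simp_rw [m] at k
    simp_rw [l, r]
    rw [integral_const_mul, integral_const_mul, k, integral_const_mul]
    ring
  have e4 : ∫ p : E × E, ‖fderiv ℝ g (c • p.1 - s • p.2)‖^2 * (gw t p.1 * gw t p.2) =
      ∫ p : E × E, ‖fderiv ℝ g p.1‖^2 * (gw t p.1 * gw t p.2) := by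
    rw [← rot_int c s h (fun p : E × E => ‖fderiv ℝ g p.1‖^2 * (gw t p.1 * gw t p.2))]
    refine integral_congr_ae (Filter.Eventually.of_forall fun p => ?_)
    dsimp only
    rw [gw_rot t c s h]
  rw [e1, e2]
  refine neg_le_neg (mul_le_mul_of_nonneg_left (mul_le_mul_of_nonneg_left ?_ (by positivity)) hs)
  calc _ ≤ ∫ p : E × E, (1/2) * (‖fderiv ℝ g (c • p.1 - s • p.2)‖^2 * (gw t p.1 * gw t p.2)
        + ‖fderiv ℝ g p.1‖^2 * (gw t p.1 * gw t p.2)) := by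
        refine integral_mono i2 ((i4.add i3).const_mul _) fun p => ?_
        have h1 := gw_pos t p.1
        have h2 := gw_pos t p.2
        have h3 := (le_abs_self _).trans (bnd p)
        have := mul_le_mul_of_nonneg_right h3 (mul_pos h1 h2).le
        dsimp only
        linarith
    _ = _ := by
        rw [integral_const_mul, integral_add i4 i3, e4]; ring

theorem gpoincare {t : ℝ} (ht : 0 < t) {g : E → ℝ} (hg : ContDiff ℝ 1 g) (A B : ℝ)
    (hA : ∀ x, |g x| ≤ A) (hB : ∀ x, ‖fderiv ℝ g x‖ ≤ B) (h0 : ∫ x, g x * gw t x = 0) :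
    2 * t * ∫ x, g x ^ 2 * gw t x ≤ ∫ x, ‖fderiv ℝ g x‖^2 * gw t x := by
  have hgc := hg.continuous
  have hwc := gw_cont (E := E) t
  have hdc := hg.continuous_fderiv one_ne_zero
  have hgd := hg.differentiable one_ne_zero
  have hB0 : 0 ≤ B := (norm_nonneg _).trans (hB 0)
  have hA0 : 0 ≤ A := (abs_nonneg _).trans (hA 0)
  set D := ∫ p : E × E, ‖fderiv ℝ g p.1‖^2 * (gw t p.1 * gw t p.2) with hD
  let H : ℝ → ℝ := fun θ => ∫ p : E × E, g p.1 * g (Real.cos θ • p.1 + Real.sin θ • p.2)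
      * (gw t p.1 * gw t p.2)
  have hH : ∀ θ, HasDerivAt H (∫ p : E × E, g p.1 *
      fderiv ℝ g (Real.cos θ • p.1 + Real.sin θ • p.2) (-Real.sin θ • p.1 + Real.cos θ • p.2)
      * (gw t p.1 * gw t p.2)) θ := by
    intro θ
    refine (hasDerivAt_integral_of_dominated_loc_of_deriv_le (s := Set.univ)
      (F' := fun θ (p : E × E) => g p.1 *
      fderiv ℝ g (Real.cos θ • p.1 + Real.sin θ • p.2) (-Real.sin θ • p.1 + Real.cos θ • p.2)
      * (gw t p.1 * gw t p.2)) (bound := fun p => A * B * ((‖p.1‖ + ‖p.2‖)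
        * (gw t p.1 * gw t p.2))) Filter.univ_mem ?_ ?_ ?_ ?_ ?_ ?_).2
    · exact Filter.Eventually.of_forall fun θ => Continuous.aestronglyMeasurable (by fun_prop)
    · refine int_bdd ht (by fun_prop) (A*A) fun p => ?_
      rw [abs_mul]
      gcongr
      · exact hA _
      · exact hA _
    · exact Continuous.aestronglyMeasurable (by fun_prop)
    · refine Filter.Eventually.of_forall fun p θ _ => ?_
      have h1 := gw_pos t p.1
      have h2 := gw_pos t p.2
      rw [norm_mul, norm_mul, Real.norm_of_nonneg (mul_pos h1 h2).le, ← mul_assoc (A*B),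
        mul_assoc A]
      have k : ‖-Real.sin θ • p.1 + Real.cos θ • p.2‖ ≤ ‖p.1‖ + ‖p.2‖ := by
        refine (norm_add_le _ _).trans ?_
        rw [norm_smul, norm_smul, norm_neg]
        refine add_le_add (mul_le_of_le_one_left (norm_nonneg _) (Real.abs_sin_le_one θ))
          (mul_le_of_le_one_left (norm_nonneg _) (Real.abs_cos_le_one θ))
      gcongr
      · exact hA _
      · exact (ContinuousLinearMap.le_opNorm _ _).trans (by gcongr; exact hB _)
    · exact (gw2_norm_int ht).const_mul _
    · refine Filter.Eventually.of_forall fun p θ _ => ?_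
      have h1 : HasDerivAt (fun θ => Real.cos θ • p.1 + Real.sin θ • p.2)
          (-Real.sin θ • p.1 + Real.cos θ • p.2) θ :=
        ((Real.hasDerivAt_cos θ).smul_const p.1).add ((Real.hasDerivAt_sin θ).smul_const p.2)
      exact (((hgd _).hasFDerivAt.comp_hasDerivAt θ h1).const_mul _).mul_const _
  have hK : ∀ θ, HasDerivAt (fun θ => H θ - Real.cos θ * (1/(2*t) * D)) _ θ := fun θ =>
    (hH θ).sub ((Real.hasDerivAt_cos θ).mul_const _)
  have hmono : MonotoneOn (fun θ => H θ - Real.cos θ * (1/(2*t) * D)) (Set.Icc 0 (Real.pi/2)) := by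
    refine monotoneOn_of_deriv_nonneg (convex_Icc _ _)
      (fun θ _ => (hK θ).continuousAt.continuousWithinAt)
      (fun θ _ => (hK θ).differentiableAt.differentiableWithinAt) fun θ hθ => ?_
    rw [interior_Icc] at hθ
    rw [(hK θ).deriv]
    have hs : 0 ≤ Real.sin θ := Real.sin_nonneg_of_nonneg_of_le_pi hθ.1.le
      (by linarith [hθ.2, Real.pi_pos])
    have := dH_bound ht hg A B hA hB (Real.cos θ) (Real.sin θ) (Real.cos_sq_add_sin_sq θ) hs
    rw [← hD] at this
    linarith
  have hfin := hmono (Set.left_mem_Icc.2 (by positivity)) (Set.right_mem_Icc.2 (by positivity))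
    (by positivity : (0:ℝ) ≤ Real.pi/2)
  have hH1 : H (Real.pi/2) = 0 := by
    have : H (Real.pi/2) = ∫ p : E × E, (g p.1 * gw t p.1) * (g p.2 * gw t p.2) := by
      refine integral_congr_ae (Filter.Eventually.of_forall fun p => ?_)
      simp; ring
    rw [this, Measure.volume_eq_prod, integral_prod_mul (fun x => g x * gw t x)
      (fun x => g x * gw t x), h0, zero_mul]
  have hH0 : H 0 = (∫ x, g x ^ 2 * gw t x) * ∫ x : E, gw t x := by
    rw [← integral_prod_mul, ← Measure.volume_eq_prod]
    refine integral_congr_ae (Filter.Eventually.of_forall fun p => ?_)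
    simp; ring
  have hD0 : D = (∫ x, ‖fderiv ℝ g x‖^2 * gw t x) * ∫ x : E, gw t x := by
    rw [← integral_prod_mul, ← Measure.volume_eq_prod]
    refine integral_congr_ae (Filter.Eventually.of_forall fun p => ?_)
    simp; ring
  have hZ : 0 < ∫ x : E, gw t x := by
    unfold gw; rw [GaussianFourier.integral_rexp_neg_mul_sq_norm (V := E) ht]; positivity
  simp only [hH1, hH0, hD0, Real.cos_zero, Real.cos_pi_div_two] at hfin
  have h2 : (∫ x, g x ^ 2 * gw t x) * (∫ x : E, gw t x) ≤
    (1/(2*t) * ∫ x, ‖fderiv ℝ g x‖^2 * gw t x) * ∫ x : E, gw t x := by linarith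
  have h3 := le_of_mul_le_mul_right h2 hZ
  rw [one_div, inv_mul_eq_div, le_div_iff₀ (by positivity)] at h3
  linarith
end aux

theorem int_div (n : ℕ) (f : EuclideanSpace ℝ (Fin n) → ℝ)
    (hf : ContDiff ℝ (⊤ : ℕ∞) f) (hsupp : HasCompactSupport f) :
    ∫ x : EuclideanSpace ℝ (Fin n), 2 * (f x * fderiv ℝ f x x) = - (n * ∫ x, f x ^ 2) := by
  have hfc := hf.continuous
  have hdc := hf.continuous_fderiv (by simp)
  have hfd := hf.differentiable (by simp)
  let b : Fin n → EuclideanSpace ℝ (Fin n) := fun i => EuclideanSpace.single i 1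
  have hx : ∀ x : EuclideanSpace ℝ (Fin n), x = ∑ i, x i • b i := fun x => by
    have := (EuclideanSpace.basisFun (Fin n) ℝ).sum_repr x
    simpa [b] using this.symm
  have hd : ∀ x, HasFDerivAt (fun x => f x ^ 2) ((2 * f x) • fderiv ℝ f x) x := fun x => by
    refine ((hfd x).hasFDerivAt.pow 2).congr_fderiv ?_
    ext v; simp
  have hp : ∀ i x, HasFDerivAt (fun x : EuclideanSpace ℝ (Fin n) => x i)
      (EuclideanSpace.proj i : EuclideanSpace ℝ (Fin n) →L[ℝ] ℝ) x := fun i x =>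
    (EuclideanSpace.proj i : EuclideanSpace ℝ (Fin n) →L[ℝ] ℝ).hasFDerivAt
  have hs2 : HasCompactSupport (fun x => f x ^ 2) := hsupp.comp_left (g := fun y => y^2) (by simp)
  have hi : ∀ i, Integrable (fun x : EuclideanSpace ℝ (Fin n) =>
      x i * (2 * f x * fderiv ℝ f x (b i))) := fun i => by
    refine Continuous.integrable_of_hasCompactSupport (by fun_prop) ?_
    exact ((hsupp.mul_left (f := fun _ => (2:ℝ))).mul_right).mul_left
  have key : ∀ i, ∫ x : EuclideanSpace ℝ (Fin n), x i * (2 * f x * fderiv ℝ f x (b i)) =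
      - ∫ x, f x ^ 2 := by
    intro i
    have e1 : ∀ x, fderiv ℝ (fun x => f x ^ 2) x (b i) = 2 * f x * fderiv ℝ f x (b i) := fun x => by
      rw [(hd x).fderiv]; simp
    have e2 : ∀ x, fderiv ℝ (fun x : EuclideanSpace ℝ (Fin n) => x i) x (b i) = 1 := fun x => by
      rw [(hp i x).fderiv]; simp [b]
    have := integral_mul_fderiv_eq_neg_fderiv_mul_of_integrable (μ := volume)
      (f := fun x : EuclideanSpace ℝ (Fin n) => x i) (g := fun x => f x ^ 2) (v := b i)
      ?_ ?_ ?_ (fun x _ => (hp i x).differentiableAt) (fun x _ => (hd x).differentiableAt)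
    · simpa only [e1, e2, one_mul] using this
    · simp only [e2, one_mul]
      exact Continuous.integrable_of_hasCompactSupport (by fun_prop) hs2
    · simp only [e1]; exact hi i
    · exact Continuous.integrable_of_hasCompactSupport (by fun_prop) hs2.mul_left
  have e3 : ∀ x, 2 * (f x * fderiv ℝ f x x) = ∑ i, x i * (2 * f x * fderiv ℝ f x (b i)) := by
    intro x
    have e4 : fderiv ℝ f x x = ∑ i, fderiv ℝ f x (x i • b i) := by
      rw [← map_sum, ← hx x]
    rw [e4, Finset.mul_sum, Finset.mul_sum]
    refine Finset.sum_congr rfl fun i _ => ?_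
    simp; ring
  simp_rw [e3]
  rw [integral_finsetSum _ (fun i _ => hi i)]
  simp [key]

theorem harmonic_oscillator_quadratic_form_gap
    (n : ℕ) (hn : 1 ≤ n) (t : ℝ) (ht : 0 < t)
    (f : EuclideanSpace ℝ (Fin n) → ℝ)
    (hf : ContDiff ℝ (⊤ : ℕ∞) f) (hsupp : HasCompactSupport f)
    (horth : ∫ x : EuclideanSpace ℝ (Fin n),
        f x * Real.exp (-t * ‖x‖ ^ 2 / 2) = 0) :
    ((n : ℝ) + 2) * t * ∫ x : EuclideanSpace ℝ (Fin n), (f x) ^ 2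
      ≤ ∫ x : EuclideanSpace ℝ (Fin n),
          (‖fderiv ℝ f x‖ ^ 2 + t ^ 2 * ‖x‖ ^ 2 * (f x) ^ 2) := by
  have hfc := hf.continuous
  have hdc := hf.continuous_fderiv (by simp)
  have hfd := hf.differentiable (by simp)
  let E := EuclideanSpace ℝ (Fin n)
  let g : E → ℝ := fun x => f x * gw (-t/2) x
  have hw : ContDiff ℝ 1 (gw (-t/2) : E → ℝ) := by
    unfold gw
    exact (contDiff_const.mul (contDiff_norm_sq ℝ)).exp
  have hg : ContDiff ℝ 1 g := (hf.of_le (by exact_mod_cast le_top)).mul hw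
  have hgs : HasCompactSupport g := hsupp.mul_right
  obtain ⟨A, hA⟩ := hgs.exists_bound_of_continuous hg.continuous
  obtain ⟨B, hB⟩ := (hgs.fderiv ℝ).exists_bound_of_continuous (hg.continuous_fderiv one_ne_zero)
  have hww : ∀ x : E, gw (-t/2) x ^ 2 * gw t x = 1 := fun x => by
    unfold gw
    rw [← Real.exp_nat_mul, ← Real.exp_add, ← Real.exp_zero]; congr 1; push_cast; ring
  have h0 : ∫ x, g x * gw t x = 0 := by
    rw [← horth]
    refine integral_congr_ae (Filter.Eventually.of_forall fun x => ?_)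
    simp only [g, gw]
    rw [mul_assoc, ← Real.exp_add]; congr 2; ring
  have P := gpoincare ht hg A B hA hB h0
  have e1 : ∫ x, g x ^ 2 * gw t x = ∫ x, f x ^ 2 := by
    refine integral_congr_ae (Filter.Eventually.of_forall fun x => ?_)
    simp only [g]
    rw [mul_pow, mul_assoc, hww, mul_one]
  have e2 : ∀ x, ‖fderiv ℝ g x‖^2 * gw t x =
      (‖fderiv ℝ f x‖ ^ 2 + t ^ 2 * ‖x‖ ^ 2 * (f x) ^ 2) + t * (2 * (f x * fderiv ℝ f x x)) := by
    intro x
    have hd : fderiv ℝ g x = gw (-t/2) x • (fderiv ℝ f x + (t * f x) • innerSL ℝ x) := by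
      refine ((hfd x).hasFDerivAt.mul (gw_fderiv (-t/2) x)).fderiv.trans ?_
      ext v; simp; ring
    rw [hd, norm_smul, mul_pow, Real.norm_eq_abs, sq_abs, mul_right_comm, hww, one_mul]
    let a : E := (InnerProductSpace.toDual ℝ E).symm (fderiv ℝ f x)
    have ha : fderiv ℝ f x = InnerProductSpace.toDual ℝ E a := by simp [a]
    have hb : fderiv ℝ f x + (t * f x) • innerSL ℝ x =
        InnerProductSpace.toDual ℝ E (a + (t * f x) • x) := by
      rw [ha]; ext v; simp
      exact Or.inl rfl
    rw [hb, ha, LinearIsometryEquiv.norm_map, LinearIsometryEquiv.norm_map, norm_add_sq_real,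
      norm_smul, inner_smul_right, InnerProductSpace.toDual_apply_apply, mul_pow, Real.norm_eq_abs,
      sq_abs]
    ring
  have i1 : Integrable (fun x : E => ‖fderiv ℝ f x‖ ^ 2 + t ^ 2 * ‖x‖ ^ 2 * (f x) ^ 2) := by
    refine Integrable.add ?_ ?_
    · exact Continuous.integrable_of_hasCompactSupport (by fun_prop)
        ((hsupp.fderiv ℝ).comp_left (g := fun y => ‖y‖^2) (by simp))
    · exact Continuous.integrable_of_hasCompactSupport (by fun_prop)
        (HasCompactSupport.mul_left (hsupp.comp_left (g := fun y => y^2) (by simp)))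
  have i2 : Integrable (fun x : E => 2 * (f x * fderiv ℝ f x x)) := by
    exact Continuous.integrable_of_hasCompactSupport (by fun_prop)
      (HasCompactSupport.mul_left (hsupp.mul_right))
  simp_rw [e2] at P
  rw [e1, integral_add i1 (i2.const_mul t), integral_const_mul, int_div n f hf hsupp] at P
  linarith
end

section
/- Let n ≥ 1, let η > 0, and let γ : ℝ → ℝ be a smooth function with γ(u) = 1 for u ≤ η/2 and γ(u) = 0 for u ≥ η. For t > 0 define w_t : EuclideanSpace ℝ (Fin n) → ℝ by w_t(x) = γ(‖x‖)·exp(−t‖x‖²/2). Then w_t is smooth with compact support, and there exist constants C, C' > 0 such that for all t ≥ 1 and all x ∈ ℝⁿ: |−Δw_t(x) + t²‖x‖²·w_t(x) − n·t·w_t(x)| ≤ C·exp(−C'·t), where Δw_t(x) = ∑_{i} D²w_t(x)(e_i, e_i) is the Laplacian (the sum of the second directional derivatives of w_t at x along the standard orthonormal basis vectors e_i). -/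
open scoped BigOperators

theorem tg_cutoff_contDiff {n : ℕ} {η : ℝ} (hη : 0 < η)
    {γ : ℝ → ℝ} (hγ : ContDiff ℝ (⊤ : ℕ∞) γ)
    (hγ₁ : ∀ u : ℝ, u ≤ η / 2 → γ u = 1) :
    ContDiff ℝ (⊤ : ℕ∞) (fun x : EuclideanSpace ℝ (Fin n) => γ ‖x‖) := by
  rw [contDiff_iff_contDiffAt]
  intro x
  by_cases hx : x = 0
  · have h : (fun x : EuclideanSpace ℝ (Fin n) => γ ‖x‖) =ᶠ[nhds x] fun _ => (1 : ℝ) := by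
      have : ∀ᶠ y in nhds x, ‖y‖ < η / 2 :=
        continuous_norm.continuousAt.eventually_lt continuousAt_const (by simp [hx, hη])
      filter_upwards [this] with y hy using hγ₁ _ hy.le
    exact contDiffAt_const.congr_of_eventuallyEq h
  · exact hγ.contDiffAt.comp x (contDiffAt_norm ℝ hx)

theorem tg_cutoff_compact {n : ℕ} {η : ℝ}
    {γ : ℝ → ℝ} (hγ₀ : ∀ u : ℝ, η ≤ u → γ u = 0) :
    HasCompactSupport (fun x : EuclideanSpace ℝ (Fin n) => γ ‖x‖) := by
  apply HasCompactSupport.intro (isCompact_closedBall 0 η)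
  intro x hx
  apply hγ₀
  simp at hx
  exact hx.le

theorem tg_first {n : ℕ} {g : EuclideanSpace ℝ (Fin n) → ℝ}
    (hg : ContDiff ℝ (⊤ : ℕ∞) g) (t : ℝ) (y : EuclideanSpace ℝ (Fin n)) (i : Fin n) :
    fderiv ℝ (fun x => g x * Real.exp (-t * ‖x‖ ^ 2 / 2)) y (EuclideanSpace.single i 1)
      = (fderiv ℝ g y (EuclideanSpace.single i 1) - t * (y i * g y))
        * Real.exp (-t * ‖y‖ ^ 2 / 2) := by
  have h1 : HasFDerivAt g (fderiv ℝ g y) y :=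
    (hg.differentiable (by simp) y).hasFDerivAt
  have h2 := ((((hasStrictFDerivAt_norm_sq (F := EuclideanSpace ℝ (Fin n)) y).hasFDerivAt).const_mul
    (-t)).mul_const (2⁻¹ : ℝ)).exp
  have h3 := h1.mul h2
  simp only [← div_eq_mul_inv] at h3
  rw [show (fun x => g x * Real.exp (-t * ‖x‖ ^ 2 / 2)) = g * (fun x => Real.exp (-t * ‖x‖ ^ 2 / 2)) from rfl, h3.fderiv]
  simp [EuclideanSpace.inner_single_right]
  ring

theorem tg_second {n : ℕ} {g : EuclideanSpace ℝ (Fin n) → ℝ}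
    (hg : ContDiff ℝ (⊤ : ℕ∞) g) (t : ℝ) (x : EuclideanSpace ℝ (Fin n)) (i : Fin n) :
    fderiv ℝ (fun y => fderiv ℝ (fun x => g x * Real.exp (-t * ‖x‖ ^ 2 / 2)) y
        (EuclideanSpace.single i 1)) x (EuclideanSpace.single i 1)
      = (fderiv ℝ (fun y => fderiv ℝ g y (EuclideanSpace.single i 1)) x
            (EuclideanSpace.single i 1)
          - 2 * t * (x i * fderiv ℝ g x (EuclideanSpace.single i 1))
          - t * g x + t ^ 2 * (x i) ^ 2 * g x)
        * Real.exp (-t * ‖x‖ ^ 2 / 2) := by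
  simp only [tg_first hg]
  have hd : ContDiff ℝ (⊤ : ℕ∞) (fun y => fderiv ℝ g y (EuclideanSpace.single i (1 : ℝ))) :=
    (hg.fderiv_right (by simp)).clm_apply contDiff_const
  have hp : ContDiff ℝ (⊤ : ℕ∞) (fun y : EuclideanSpace ℝ (Fin n) => y i) := by fun_prop
  have hG : ContDiff ℝ (⊤ : ℕ∞) (fun y =>
      fderiv ℝ g y (EuclideanSpace.single i (1 : ℝ)) - t * (y i * g y)) :=
    hd.sub (contDiff_const.mul (hp.mul hg))
  rw [tg_first hG]
  have e1 : HasFDerivAt (fun y => fderiv ℝ g y (EuclideanSpace.single i (1 : ℝ))) _ x :=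
    (hd.differentiable (by simp) x).hasFDerivAt
  have e2 : HasFDerivAt g _ x := (hg.differentiable (by simp) x).hasFDerivAt
  have e3 : HasFDerivAt (fun y : EuclideanSpace ℝ (Fin n) => y i)
      (EuclideanSpace.proj (𝕜 := ℝ) i) x :=
    (EuclideanSpace.proj (𝕜 := ℝ) i : EuclideanSpace ℝ (Fin n) →L[ℝ] ℝ).hasFDerivAt
  have e4 : HasFDerivAt (fun y =>
      fderiv ℝ g y (EuclideanSpace.single i (1 : ℝ)) - t * (y i * g y)) _ x :=
    e1.sub ((e3.mul e2).const_mul t)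
  rw [e4.fderiv]
  simp
  ring

theorem tg_lap {n : ℕ} {g : EuclideanSpace ℝ (Fin n) → ℝ}
    (hg : ContDiff ℝ (⊤ : ℕ∞) g) (t : ℝ) (x : EuclideanSpace ℝ (Fin n)) :
    euclideanLaplacian (fun x => g x * Real.exp (-t * ‖x‖ ^ 2 / 2)) x
      = (euclideanLaplacian g x
          - 2 * t * (∑ i, x i * fderiv ℝ g x (EuclideanSpace.single i 1))
          - n * t * g x + t ^ 2 * ‖x‖ ^ 2 * g x)
        * Real.exp (-t * ‖x‖ ^ 2 / 2) := by
  unfold euclideanLaplacian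
  simp only [tg_second hg]
  rw [← Finset.sum_mul, Finset.sum_add_distrib, Finset.sum_sub_distrib, Finset.sum_sub_distrib,
    ← Finset.mul_sum, ← Finset.sum_mul, ← Finset.sum_mul, ← Finset.mul_sum, EuclideanSpace.real_norm_sq_eq]
  simp

theorem tg_bdd {n : ℕ} {g : EuclideanSpace ℝ (Fin n) → ℝ}
    (hg : ContDiff ℝ (⊤ : ℕ∞) g) (hc : HasCompactSupport g) :
    ∃ M : ℝ, 0 ≤ M ∧ ∀ x, |euclideanLaplacian g x| ≤ M ∧
      |∑ i, x i * fderiv ℝ g x (EuclideanSpace.single i 1)| ≤ M := by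
  have hd : ∀ i : Fin n,
      ContDiff ℝ (⊤ : ℕ∞) (fun y => fderiv ℝ g y (EuclideanSpace.single i (1 : ℝ))) :=
    fun i => (hg.fderiv_right (by simp)).clm_apply contDiff_const
  have hdc : ∀ i : Fin n, HasCompactSupport (fun y => fderiv ℝ g y (EuclideanSpace.single i (1 : ℝ))) :=
    fun i => hc.fderiv_apply (𝕜 := ℝ) _
  have b1 : ∀ i : Fin n, ∃ C, ∀ x, ‖fderiv ℝ (fun y => fderiv ℝ g y (EuclideanSpace.single i 1)) x
      (EuclideanSpace.single i (1 : ℝ))‖ ≤ C := fun i =>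
    ((hdc i).fderiv_apply (𝕜 := ℝ) _).exists_bound_of_continuous
      (((hd i).fderiv_right (m := (⊤ : ℕ∞)) (by simp)).clm_apply contDiff_const).continuous
  have b2 : ∀ i : Fin n, ∃ C, ∀ x : EuclideanSpace ℝ (Fin n),
      ‖x i * fderiv ℝ g x (EuclideanSpace.single i (1 : ℝ))‖ ≤ C := fun i =>
    ((hdc i).mul_left (f := fun x : EuclideanSpace ℝ (Fin n) => x i)).exists_bound_of_continuous
      (Continuous.mul (by fun_prop) (hd i).continuous)
  choose C1 h1 using b1
  choose C2 h2 using b2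
  refine ⟨max 0 (max (∑ i, C1 i) (∑ i, C2 i)), le_max_left _ _, fun x => ⟨?_, ?_⟩⟩
  · refine le_trans ?_ ((le_max_left _ _).trans (le_max_right _ _))
    exact (Finset.abs_sum_le_sum_abs _ _).trans (Finset.sum_le_sum fun i _ => h1 i x)
  · refine le_trans ?_ ((le_max_right _ _).trans (le_max_right _ _))
    exact (Finset.abs_sum_le_sum_abs _ _).trans (Finset.sum_le_sum fun i _ => h2 i x)

theorem tg_zero {n : ℕ} {g : EuclideanSpace ℝ (Fin n) → ℝ} {x : EuclideanSpace ℝ (Fin n)}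
    (h : g =ᶠ[nhds x] fun _ => (1 : ℝ)) :
    euclideanLaplacian g x = 0 ∧ ∑ i, x i * fderiv ℝ g x (EuclideanSpace.single i 1) = 0 := by
  have h1 : fderiv ℝ g =ᶠ[nhds x] fun _ => 0 := by
    have := h.fderiv (𝕜 := ℝ)
    simp only [fderiv_fun_const] at this
    exact this
  constructor
  · apply Finset.sum_eq_zero
    intro i _
    have : (fun y => fderiv ℝ g y (EuclideanSpace.single i (1 : ℝ))) =ᶠ[nhds x] fun _ => 0 := by
      filter_upwards [h1] with y hy
      simp [hy]
    rw [this.fderiv_eq]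
    simp
  · apply Finset.sum_eq_zero
    intro i _
    simp [h1.eq_of_nhds]

/-- **The truncated Gaussian is an approximate eigenfunction (Prop. 4.3(1), scalar case).**
Let `γ` be a smooth cutoff, equal to `1` on `(−∞, η/2]` and `0` on `[η, ∞)`.
Then each truncated Gaussian `w_t x = γ(‖x‖)·exp(−t‖x‖²/2)` is smooth with
compact support, and there are constants `C, C' > 0` such that for all `t ≥ 1`
and all `x`, `|−Δw_t(x) + t²‖x‖² w_t(x) − n·t·w_t(x)| ≤ C·exp(−C't)`. -/
theorem truncated_gaussian_approximate_eigenfunction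
    (n : ℕ) (hn : 1 ≤ n) (η : ℝ) (hη : 0 < η)
    (γ : ℝ → ℝ) (hγ : ContDiff ℝ (⊤ : ℕ∞) γ)
    (hγ₁ : ∀ u : ℝ, u ≤ η / 2 → γ u = 1)
    (hγ₀ : ∀ u : ℝ, η ≤ u → γ u = 0) :
    let w : ℝ → EuclideanSpace ℝ (Fin n) → ℝ := fun t x =>
      γ ‖x‖ * Real.exp (-t * ‖x‖ ^ 2 / 2)
    (∀ t : ℝ, 0 < t → ContDiff ℝ (⊤ : ℕ∞) (w t) ∧ HasCompactSupport (w t)) ∧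
      ∃ C C' : ℝ, 0 < C ∧ 0 < C' ∧
        ∀ t : ℝ, 1 ≤ t → ∀ x : EuclideanSpace ℝ (Fin n),
          |-(euclideanLaplacian (w t) x) + t ^ 2 * ‖x‖ ^ 2 * w t x
              - (n : ℝ) * t * w t x| ≤ C * Real.exp (-C' * t) := by
  intro w
  have hg := tg_cutoff_contDiff (n := n) hη hγ hγ₁
  have hc := tg_cutoff_compact (n := n) hγ₀
  refine ⟨fun t _ => ⟨?_, hc.mul_right⟩, ?_⟩
  · refine hg.mul (Real.contDiff_exp.comp ?_)
    exact (contDiff_const.mul (contDiff_norm_sq ℝ)).div_const _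
  obtain ⟨M, hM, hb⟩ := tg_bdd hg hc
  refine ⟨48 * M / η ^ 2 + 1, η ^ 2 / 16, by positivity, by positivity, fun t ht x => ?_⟩
  have hw : w t = fun x => γ ‖x‖ * Real.exp (-t * ‖x‖ ^ 2 / 2) := rfl
  rw [hw, tg_lap hg t x]
  set A := euclideanLaplacian (fun x : EuclideanSpace ℝ (Fin n) => γ ‖x‖) x with hA
  set B := ∑ i, x i * fderiv ℝ (fun x : EuclideanSpace ℝ (Fin n) => γ ‖x‖) x
    (EuclideanSpace.single i 1) with hB
  set E := Real.exp (-t * ‖x‖ ^ 2 / 2) with hE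
  obtain ⟨hA1, hB1⟩ := hb x
  rw [← hA] at hA1
  rw [← hB] at hB1
  have key : -((A - 2 * t * B - n * t * γ ‖x‖ + t ^ 2 * ‖x‖ ^ 2 * γ ‖x‖) * E)
      + t ^ 2 * ‖x‖ ^ 2 * (γ ‖x‖ * E) - n * t * (γ ‖x‖ * E) = (2 * t * B - A) * E := by ring
  rw [key]
  by_cases hx : ‖x‖ < η / 2
  · have h : (fun x : EuclideanSpace ℝ (Fin n) => γ ‖x‖) =ᶠ[nhds x] fun _ => (1 : ℝ) := by
      have : ∀ᶠ y in nhds x, ‖y‖ < η / 2 :=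
        continuous_norm.continuousAt.eventually_lt continuousAt_const hx
      filter_upwards [this] with y hy using hγ₁ _ hy.le
    obtain ⟨z1, z2⟩ := tg_zero h
    rw [hA, hB, z1, z2]
    simp
    positivity
  · push Not at hx
    have hE1 : E ≤ Real.exp (-(η ^ 2 / 16) * t) * Real.exp (-(η ^ 2 / 16) * t) := by
      rw [← Real.exp_add, hE]
      apply Real.exp_le_exp.mpr
      have : η ^ 2 / 4 ≤ ‖x‖ ^ 2 := by nlinarith
      nlinarith
    set F := Real.exp (-(η ^ 2 / 16) * t) with hF
    have hF0 : 0 < F := Real.exp_pos _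
    have htF : t * F ≤ 16 / η ^ 2 := by
      have h1 : η ^ 2 / 16 * t ≤ Real.exp (η ^ 2 / 16 * t) := by
        linarith [Real.add_one_le_exp (η ^ 2 / 16 * t)]
      have h2 : Real.exp (η ^ 2 / 16 * t) * F = 1 := by
        rw [hF, ← Real.exp_add]; simp
      have h3 : η ^ 2 / 16 * t * F ≤ 1 := by
        rw [← h2]; exact mul_le_mul_of_nonneg_right h1 hF0.le
      rw [le_div_iff₀ (by positivity)]
      linarith
    have hAB : |2 * t * B - A| ≤ 3 * M * t := by
      have h1 : |2 * t * B - A| ≤ |2 * t * B| + |A| := abs_sub _ _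
      have h2 : |2 * t * B| = 2 * t * |B| := by
        rw [abs_mul, abs_of_nonneg (by linarith)]
      have h3 : 2 * t * |B| ≤ 2 * t * M := mul_le_mul_of_nonneg_left hB1 (by linarith)
      nlinarith
    rw [abs_mul, abs_of_pos (Real.exp_pos _)]
    calc |2 * t * B - A| * E ≤ (3 * M * t) * (F * F) :=
          mul_le_mul hAB hE1 (Real.exp_pos _).le (by positivity)
      _ = 3 * M * (t * F) * F := by ring
      _ ≤ 3 * M * (16 / η ^ 2) * F := by gcongr
      _ = 48 * M / η ^ 2 * F := by ring
      _ ≤ (48 * M / η ^ 2 + 1) * F := by nlinarith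
end

section
/- Let n ≥ 1 and t > 0. The set of functions ℝⁿ → ℝ of the form x ↦ p(x)·exp(−t‖x‖²/2), where p ranges over real polynomials in n variables, spans a dense subspace of the real Hilbert space L²(EuclideanSpace ℝ (Fin n)) (square-integrable real-valued functions with respect to Lebesgue measure). -/
open MeasureTheory

lemma aux_toReal_ofReal (a : ℝ) : (ENNReal.ofReal a).toReal = max a 0 := by
  rw [ENNReal.toReal_ofReal']

lemma aux_memLp_exp (n : ℕ) (t : ℝ) (ht : 0 < t) (c : ℝ) :
    MemLp (fun x : EuclideanSpace ℝ (Fin n) =>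
      Real.exp (c * ‖x‖) * Real.exp (-t * ‖x‖ ^ 2 / 2)) 2 volume := by
  have h1 : MemLp (fun x : EuclideanSpace ℝ (Fin n) => Real.exp (-(t / 4) * ‖x‖ ^ 2))
      2 volume := by
    rw [memLp_two_iff_integrable_sq (by fun_prop)]
    have := (GaussianFourier.integrable_cexp_neg_mul_sq_norm_add
      (V := EuclideanSpace ℝ (Fin n)) (b := ((t / 2 : ℝ) : ℂ))
      (by rw [Complex.ofReal_re]; positivity) 0 0).norm
    refine this.congr (Filter.Eventually.of_forall fun x => ?_)
    simp only [Complex.norm_exp, zero_mul, add_zero]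
    rw [← Real.exp_nat_mul]
    congr 1
    have : (-((t / 2 : ℝ) : ℂ) * (‖x‖ : ℂ) ^ 2) = ((-(t / 2) * ‖x‖ ^ 2 : ℝ) : ℂ) := by
      push_cast; ring
    rw [this, Complex.ofReal_re]
    push_cast; ring
  refine h1.of_le_mul (c := Real.exp (c ^ 2 / t)) (by fun_prop)
    (Filter.Eventually.of_forall fun x => ?_)
  rw [← Real.exp_add, Real.norm_eq_abs, Real.norm_eq_abs, Real.abs_exp, Real.abs_exp,
    ← Real.exp_add, Real.exp_le_exp]
  have h : c ^ 2 / t + -(t / 4) * ‖x‖ ^ 2 - (c * ‖x‖ + -t * ‖x‖ ^ 2 / 2)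
      = (c - t * ‖x‖ / 2) ^ 2 / t := by
    field_simp; ring
  have : 0 ≤ (c - t * ‖x‖ / 2) ^ 2 / t := by positivity
  linarith

lemma aux_poly_bound (n : ℕ) (p : MvPolynomial (Fin n) ℝ) :
    ∃ C c : ℝ, 0 ≤ C ∧ 0 ≤ c ∧ ∀ x : EuclideanSpace ℝ (Fin n),
      |MvPolynomial.eval (fun i => x i) p| ≤ C * Real.exp (c * ‖x‖) := by
  induction p using MvPolynomial.induction_on with
  | C a => exact ⟨|a|, 0, abs_nonneg _, le_rfl, fun x => by simp⟩
  | add p q hp hq =>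
    obtain ⟨C, c, hC, hc, h⟩ := hp
    obtain ⟨D, d, hD, hd, h'⟩ := hq
    refine ⟨C + D, c + d, by positivity, by positivity, fun x => ?_⟩
    rw [map_add]
    refine (abs_add_le _ _).trans ((add_le_add (h x) (h' x)).trans ?_)
    rw [add_mul]
    have : 0 ≤ c * ‖x‖ := by positivity
    have : 0 ≤ d * ‖x‖ := by positivity
    gcongr <;> linarith
  | mul_X p i hp =>
    obtain ⟨C, c, hC, hc, h⟩ := hp
    refine ⟨C, c + 1, hC, by positivity, fun x => ?_⟩
    rw [map_mul, abs_mul, MvPolynomial.eval_X, add_mul, Real.exp_add, ← mul_assoc]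
    refine mul_le_mul (h x) ?_ (abs_nonneg _) (by positivity)
    have h1 : |x i| ≤ ‖x‖ := by simpa using PiLp.norm_apply_le x i
    have := Real.add_one_le_exp (1 * ‖x‖)
    linarith

lemma aux_poly_cont (n : ℕ) (p : MvPolynomial (Fin n) ℝ) :
    Continuous fun x : EuclideanSpace ℝ (Fin n) => MvPolynomial.eval (fun i => x i) p := by
  have := MvPolynomial.continuous_eval p
  exact this.comp (by fun_prop)

lemma aux_memLp_poly (n : ℕ) (t : ℝ) (ht : 0 < t) (p : MvPolynomial (Fin n) ℝ) :
    MemLp (fun x : EuclideanSpace ℝ (Fin n) =>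
      MvPolynomial.eval (fun i => x i) p * Real.exp (-t * ‖x‖ ^ 2 / 2)) 2 volume := by
  obtain ⟨C, c, hC, hc, h⟩ := aux_poly_bound n p
  refine (aux_memLp_exp n t ht c).of_le_mul (c := C) ?_ (Filter.Eventually.of_forall fun x => ?_)
  · have := aux_poly_cont n p
    exact Continuous.aestronglyMeasurable (by fun_prop)
  · simp only [norm_mul, Real.norm_eq_abs, Real.abs_exp]
    rw [← mul_assoc]
    gcongr
    exact h x

lemma aux_fourier_inj (n : ℕ) (h : EuclideanSpace ℝ (Fin n) → ℝ) (hi : Integrable h)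
    (h0 : ∀ v : EuclideanSpace ℝ (Fin n),
      ∫ x, (h x : ℂ) * Complex.exp (((inner ℝ x v : ℝ) : ℂ) * Complex.I) = 0) :
    h =ᵐ[volume] 0 := by
  have := isFiniteMeasure_withDensity_ofReal hi.2
  have := isFiniteMeasure_withDensity_ofReal hi.neg.2
  have hm : AEMeasurable h := hi.1.aemeasurable
  have key : volume.withDensity (fun x => ENNReal.ofReal (h x))
      = volume.withDensity (fun x => ENNReal.ofReal ((-h) x)) := by
    apply Measure.ext_of_charFun
    ext v
    rw [charFun_apply, charFun_apply, integral_withDensity_eq_integral_toReal_smul₀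
      hm.ennreal_ofReal (by simp), integral_withDensity_eq_integral_toReal_smul₀
      hm.neg.ennreal_ofReal (by simp), ← sub_eq_zero, ← integral_sub]
    · rw [← h0 v]
      congr 1
      ext x
      rw [← sub_smul, Complex.real_smul, Pi.neg_apply, aux_toReal_ofReal,
        aux_toReal_ofReal, max_zero_sub_max_neg_zero_eq_self]
    · refine hi.norm.mono' ?_ (Filter.Eventually.of_forall fun x => ?_)
      · exact hm.ennreal_ofReal.ennreal_toReal.aestronglyMeasurable.smul
          (Continuous.aestronglyMeasurable (by fun_prop))
      · rw [norm_smul, Complex.norm_exp_ofReal_mul_I, mul_one, aux_toReal_ofReal]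
        simp only [Real.norm_eq_abs]
        rw [abs_of_nonneg (le_max_right _ _)]
        exact max_le (le_abs_self _) (abs_nonneg _)
    · refine hi.norm.mono' ?_ (Filter.Eventually.of_forall fun x => ?_)
      · exact hm.neg.ennreal_ofReal.ennreal_toReal.aestronglyMeasurable.smul
          (Continuous.aestronglyMeasurable (by fun_prop))
      · rw [norm_smul, Complex.norm_exp_ofReal_mul_I, mul_one, aux_toReal_ofReal]
        simp only [Real.norm_eq_abs]
        rw [abs_of_nonneg (le_max_right _ _)]
        exact max_le (neg_le_abs _) (abs_nonneg _)
  rw [withDensity_eq_iff_of_sigmaFinite hm.ennreal_ofReal hm.neg.ennreal_ofReal] at key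
  filter_upwards [key] with x hx
  have hx := congrArg ENNReal.toReal hx
  rw [aux_toReal_ofReal, aux_toReal_ofReal] at hx
  have := max_zero_sub_max_neg_zero_eq_self (h x)
  simp only [Pi.neg_apply] at hx
  simp only [Pi.zero_apply]
  linarith

lemma aux_fourier_zero (n : ℕ) (h : EuclideanSpace ℝ (Fin n) → ℝ)
    (hm : AEStronglyMeasurable h volume)
    (hi : ∀ c : ℝ, Integrable fun x => |h x| * Real.exp (c * ‖x‖))
    (h0 : ∀ p : MvPolynomial (Fin n) ℝ, ∫ x, h x * MvPolynomial.eval (fun i => x i) p = 0)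
    (v : EuclideanSpace ℝ (Fin n)) :
    ∫ x, (h x : ℂ) * Complex.exp (((inner ℝ x v : ℝ) : ℂ) * Complex.I) = 0 := by
  have hR : ∀ y : ℝ, HasSum (fun k : ℕ => y ^ k / (k.factorial : ℝ)) (Real.exp y) := fun y => by
    rw [Real.exp_eq_exp_ℝ]; exact NormedSpace.expSeries_div_hasSum_exp y
  have hCx : ∀ y : ℂ, HasSum (fun k : ℕ => y ^ k / (k.factorial : ℂ)) (Complex.exp y) :=
    fun y => by
      rw [Complex.exp_eq_exp_ℂ]; exact NormedSpace.expSeries_div_hasSum_exp y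
  have hb : ∀ x, HasSum (fun k : ℕ => |h x| * ((‖v‖ * ‖x‖) ^ k / (k.factorial : ℝ)))
      (|h x| * Real.exp (‖v‖ * ‖x‖)) := fun x => (hR _).mul_left _
  have := hasSum_integral_of_dominated_convergence (μ := volume)
    (F := fun (k : ℕ) (x : EuclideanSpace ℝ (Fin n)) =>
      (h x : ℂ) * ((((inner ℝ x v : ℝ) : ℂ) * Complex.I) ^ k / (k.factorial : ℂ)))
    (f := fun x => (h x : ℂ) * Complex.exp (((inner ℝ x v : ℝ) : ℂ) * Complex.I))
    (fun k x => |h x| * ((‖v‖ * ‖x‖) ^ k / (k.factorial : ℝ)))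
    (fun k => (Complex.continuous_ofReal.comp_aestronglyMeasurable hm).mul
      (Continuous.aestronglyMeasurable (by fun_prop)))
    (fun k => Filter.Eventually.of_forall fun x => by
      simp only [norm_mul, norm_div, norm_pow, Complex.norm_real, Complex.norm_I, mul_one,
        Complex.norm_natCast, Real.norm_eq_abs]
      gcongr
      rw [mul_comm]
      exact abs_real_inner_le_norm x v)
    (Filter.Eventually.of_forall fun x => (hb x).summable)
    (by simp_rw [fun x => (hb x).tsum_eq]; exact hi _)
    (Filter.Eventually.of_forall fun x => (hCx _).mul_left _)
  refine this.unique ?_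
  convert hasSum_zero with k
  have e : ∀ x : EuclideanSpace ℝ (Fin n),
      (h x : ℂ) * ((((inner ℝ x v : ℝ) : ℂ) * Complex.I) ^ k / (k.factorial : ℂ))
      = ((h x * MvPolynomial.eval (fun i => x i)
          ((∑ i, MvPolynomial.C (v i) * MvPolynomial.X i) ^ k) : ℝ) : ℂ)
          * (Complex.I ^ k / (k.factorial : ℂ)) := fun x => by
    have : inner ℝ x v = MvPolynomial.eval (fun i => x i)
          (∑ i, MvPolynomial.C (v i) * MvPolynomial.X i) := by
      simp [PiLp.inner_apply]
    rw [map_pow, ← this]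
    push_cast
    ring
  simp_rw [e]
  rw [integral_mul_const, integral_complex_ofReal, h0]
  simp

/-- **Completeness of the Hermite functions in `L²(ℝⁿ)`.**
For `t > 0`, the functions `x ↦ p(x)·exp(−t‖x‖²/2)`, where `p` ranges over real
polynomials in `n` variables, span a dense subspace of the real Hilbert space
`L²(ℝⁿ)` of square-integrable functions with respect to Lebesgue measure. -/
theorem polynomial_gaussian_span_dense_in_L2
    (n : ℕ) (hn : 1 ≤ n) (t : ℝ) (ht : 0 < t) :
    Dense (↑(Submodule.span ℝ
      {g : Lp ℝ 2 (volume : Measure (EuclideanSpace ℝ (Fin n))) |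
        ∃ p : MvPolynomial (Fin n) ℝ,
          (g : EuclideanSpace ℝ (Fin n) → ℝ)
            =ᵐ[volume] fun x =>
              MvPolynomial.eval (fun i => x i) p * Real.exp (-t * ‖x‖ ^ 2 / 2)}) :
      Set (Lp ℝ 2 (volume : Measure (EuclideanSpace ℝ (Fin n))))) := by
  rw [Submodule.dense_iff_topologicalClosure_eq_top, Submodule.topologicalClosure_eq_top_iff,
    Submodule.eq_bot_iff]
  intro f hf
  rw [Submodule.mem_orthogonal] at hf
  have hfm : MemLp (f : EuclideanSpace ℝ (Fin n) → ℝ) 2 volume := Lp.memLp f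
  set h : EuclideanSpace ℝ (Fin n) → ℝ := fun x => f x * Real.exp (-t * ‖x‖ ^ 2 / 2) with hh
  have hm : AEStronglyMeasurable h volume :=
    hfm.1.mul (Continuous.aestronglyMeasurable (by fun_prop))
  have hi : ∀ c : ℝ, Integrable fun x => |h x| * Real.exp (c * ‖x‖) := fun c => by
    refine (hfm.integrable_mul (aux_memLp_exp n t ht c)).norm.congr
      (Filter.Eventually.of_forall fun x => ?_)
    simp only [hh, Pi.mul_apply, norm_mul, Real.norm_eq_abs, abs_mul, Real.abs_exp]
    ring
  have h0 : ∀ p : MvPolynomial (Fin n) ℝ,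
      ∫ x, h x * MvPolynomial.eval (fun i => x i) p = 0 := fun p => by
    have hp := aux_memLp_poly n t ht p
    have := hf (hp.toLp _) (Submodule.subset_span ⟨p, hp.coeFn_toLp⟩)
    rw [L2.inner_def] at this
    rw [← this]
    refine integral_congr_ae ?_
    filter_upwards [hp.coeFn_toLp] with x hx
    rw [hx]
    simp only [hh, RCLike.inner_apply, conj_trivial]
    ring
  have hi0 : Integrable h := by
    rw [← integrable_norm_iff hm]
    simpa using hi 0
  have hz := aux_fourier_inj n h hi0 (aux_fourier_zero n h hm hi h0)
  rw [Lp.eq_zero_iff_ae_eq_zero]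
  filter_upwards [hz] with x hx
  simpa [hh, Real.exp_ne_zero] using hx
end
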